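/- arXiv:2310.18323 — 7 statements merged into one kernel-verified Lean document; each statement's English description precedes it below -/
import Mathlib

section
/- AdaBoost training error bound: Let y ∈ {−1,1}^m with m ≥ 1. Let W_0 be the uniform weight vector W_{0,i} = 1/m. For t = 1,…,T let h_t ∈ {−1,1}^m be a classifier, let ε_t = ∑_{i : h_{t,i} ≠ y_i} W_{t−1,i} be its weighted error, assume 0 < ε_t < 1, set α_t = (1/2)·log((1−ε_t)/ε_t), Z_t = ∑_{i=1}^m W_{t−1,i}·exp(−α_t y_i h_{t,i}), and W_{t,i} = W_{t−1,i}·exp(−α_t y_i h_{t,i})/Z_t. Then the fraction of training examples misclassified by the final combined classifier satisfies (1/m)·|{ i : y_i · ∑_{t=1}^T α_t h_{t,i} ≤ 0 }| ≤ ∏_{t=1}^T 2·√(ε_t(1−ε_t)). -/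
open scoped Classical
open Finset

/-- The half log-odds weight balances the two exponential terms to the Bhattacharyya factor. -/
lemma exp_half_log_odds_balance {e : ℝ} (h0 : 0 < e) (h1 : e < 1) :
    e * Real.exp (1 / 2 * Real.log ((1 - e) / e))
      + (1 - e) * Real.exp (-(1 / 2 * Real.log ((1 - e) / e))) = 2 * √(e * (1 - e)) := by
  have h1' : 0 < 1 - e := sub_pos.2 h1
  have hexp : Real.exp (1 / 2 * Real.log ((1 - e) / e)) = √(1 - e) / √e := by
    rw [← Real.sqrt_div h1'.le, Real.sqrt_eq_rpow, Real.rpow_def_of_pos (div_pos h1' h0), mul_comm]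
  rw [Real.exp_neg, hexp, Real.sqrt_mul h0.le]
  have hs := Real.sqrt_pos.2 h0
  have hr := Real.sqrt_pos.2 h1'
  have hs2 := Real.sq_sqrt h0.le
  have hr2 := Real.sq_sqrt h1'.le
  generalize √e = s at *
  generalize √(1 - e) = r at *
  rw [← hr2, ← hs2]
  field_simp
  ring

/-- Unrolling a normalized multiplicative-weights recursion. -/
lemma mul_prod_normalizers_eq {T : ℕ} (w : ℕ → ℝ) (c Z : Fin T → ℝ) (hZ : ∀ t, Z t ≠ 0)
    (hw : ∀ t : Fin T, w ((t : ℕ) + 1) = w t * Real.exp (c t) / Z t) :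
    w T * ∏ t, Z t = w 0 * Real.exp (∑ t, c t) := by
  induction T with
  | zero => simp
  | succ T ih =>
    have ih' := ih (fun t => c t.castSucc) (fun t => Z t.castSucc) (fun t => hZ _)
      (fun t => hw t.castSucc)
    have hlast := hw (Fin.last T)
    rw [Fin.val_last] at hlast
    rw [Fin.prod_univ_castSucc, Fin.sum_univ_castSucc, Real.exp_add, ← mul_assoc (w 0), ← ih',
      hlast]
    field_simp [hZ (Fin.last T)]

/-- The exponential-loss normalizer in terms of the weighted error. -/
lemma sum_mul_exp_neg_margin {m : ℕ} (y g w : Fin m → ℝ) (a : ℝ)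
    (hy : ∀ i, y i = 1 ∨ y i = -1) (hg : ∀ i, g i = 1 ∨ g i = -1) (hw : ∑ i, w i = 1) :
    ∑ i, w i * Real.exp (-a * (y i * g i))
      = (∑ i ∈ univ.filter (fun i => g i ≠ y i), w i) * Real.exp a
        + (1 - ∑ i ∈ univ.filter (fun i => g i ≠ y i), w i) * Real.exp (-a) := by
  have hsplit : 1 - ∑ i ∈ univ.filter (fun i => g i ≠ y i), w i
      = ∑ i ∈ univ.filter (fun i => ¬ g i ≠ y i), w i := by
    rw [← hw, ← sum_filter_add_sum_filter_not univ (fun i => g i ≠ y i) w]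
    ring
  rw [hsplit, ← sum_filter_add_sum_filter_not univ (fun i => g i ≠ y i), sum_mul, sum_mul]
  congr 1 <;> refine sum_congr rfl fun i hi => ?_ <;> have hi := (mem_filter.1 hi).2 <;>
    rcases hy i with h1 | h1 <;> rcases hg i with h2 | h2 <;> rw [h1, h2] at hi ⊢ <;>
    first | (norm_num; done) | norm_num at hi

/-- AdaBoost training error bound. -/
theorem adaboost_training_error_bound
    (m T : ℕ) (hm : 1 ≤ m)
    (y : Fin m → ℝ) (hy : ∀ i, y i = 1 ∨ y i = -1)
    (h : Fin T → Fin m → ℝ) (hh : ∀ t i, h t i = 1 ∨ h t i = -1)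
    (W : ℕ → Fin m → ℝ)
    (hW0 : ∀ i, W 0 i = 1 / m)
    (ε : Fin T → ℝ)
    (hε : ∀ t : Fin T, ε t = ∑ i ∈ Finset.univ.filter (fun i => h t i ≠ y i), W t i)
    (hεpos : ∀ t, 0 < ε t) (hεlt : ∀ t, ε t < 1)
    (α : Fin T → ℝ)
    (hα : ∀ t, α t = (1 / 2) * Real.log ((1 - ε t) / ε t))
    (Z : Fin T → ℝ)
    (hZ : ∀ t, Z t = ∑ i, W t i * Real.exp (-(α t) * (y i * h t i)))
    (hWrec : ∀ (t : Fin T) (i : Fin m),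
      W ((t : ℕ) + 1) i = W t i * Real.exp (-(α t) * (y i * h t i)) / Z t) :
    ((Finset.univ.filter (fun i : Fin m => y i * ∑ t, α t * h t i ≤ 0)).card : ℝ) / m
      ≤ ∏ t, 2 * Real.sqrt (ε t * (1 - ε t)) := by
  have hZ_of_sum : ∀ t : Fin T, ∑ i, W t i = 1 → Z t = 2 * √(ε t * (1 - ε t)) := by
    intro t ht
    rw [hZ t, sum_mul_exp_neg_margin y (h t) (W t) (α t) hy (hh t) ht, ← hε t, hα t,
      exp_half_log_odds_balance (hεpos t) (hεlt t)]
  have hbound_pos : ∀ t : Fin T, 0 < 2 * √(ε t * (1 - ε t)) := fun t =>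
    mul_pos two_pos (Real.sqrt_pos.2 (mul_pos (hεpos t) (sub_pos.2 (hεlt t))))
  have hm0 : (0 : ℝ) < m := by exact_mod_cast hm
  have hsum : ∀ k ≤ T, ∑ i, W k i = 1 := by
    intro k
    induction k with
    | zero =>
      intro _
      simp [hW0, hm0.ne']
    | succ k ih =>
      intro hk
      have hne : Z ⟨k, hk⟩ ≠ 0 := by
        rw [hZ_of_sum ⟨k, hk⟩ (ih (by omega))]
        exact (hbound_pos _).ne'
      rw [sum_congr rfl fun i _ => hWrec ⟨k, hk⟩ i, ← sum_div, ← hZ ⟨k, hk⟩, div_self hne]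
  have hZeq : ∀ t, Z t = 2 * √(ε t * (1 - ε t)) := fun t => hZ_of_sum t (hsum t t.2.le)
  have hunroll : ∀ i, W T i * ∏ t, Z t
      = 1 / m * Real.exp (-(y i * ∑ t, α t * h t i)) := by
    intro i
    rw [mul_prod_normalizers_eq (fun k => W k i) (fun t => -(α t) * (y i * h t i)) Z
      (fun t => (hZeq t).symm ▸ (hbound_pos t).ne') (fun t => hWrec t i), hW0 i, mul_sum,
      ← sum_neg_distrib]
    congr 2
    exact sum_congr rfl fun t _ => by ring
  calc ((univ.filter (fun i : Fin m => y i * ∑ t, α t * h t i ≤ 0)).card : ℝ) / m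
      = ∑ i ∈ univ.filter (fun i : Fin m => y i * ∑ t, α t * h t i ≤ 0), (1 / m : ℝ) := by
        rw [sum_const, nsmul_eq_mul, mul_one_div]
    _ ≤ ∑ i ∈ univ.filter (fun i : Fin m => y i * ∑ t, α t * h t i ≤ 0),
          1 / m * Real.exp (-(y i * ∑ t, α t * h t i)) := by
        refine sum_le_sum fun i hi => le_mul_of_one_le_right (by positivity) ?_
        exact Real.one_le_exp (neg_nonneg.2 (mem_filter.1 hi).2)
    _ ≤ ∑ i, 1 / m * Real.exp (-(y i * ∑ t, α t * h t i)) :=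
        sum_le_sum_of_subset_of_nonneg (filter_subset _ _) fun i _ _ => by positivity
    _ = ∏ t, Z t := by
        rw [← sum_congr rfl fun i _ => hunroll i, ← sum_mul, hsum T le_rfl, one_mul]
    _ = ∏ t, 2 * Real.sqrt (ε t * (1 - ε t)) := prod_congr rfl fun t _ => hZeq t
end

section
/- AdaBoost as gradient descent (equivalence of selection criteria): Fix y ∈ {−1,1}^m, F ∈ ℝ^m, and define C : ℝ^m → ℝ by C(G) = (1/m)·∑_{i=1}^m exp(−y_i G_i), and weights W_i = exp(−y_i F_i)/∑_{j=1}^m exp(−y_j F_j). Then for any finite nonempty set H ⊆ {−1,1}^m of classifiers, an element h* ∈ H maximizes over h ∈ H the negative directional derivative −(d/ds) C(F + s·h)|_{s=0} if and only if h* minimizes over h ∈ H the weighted error ∑_{i : h_i ≠ y_i} W_i. -/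
open scoped Classical
open Finset

/-- The negative directional derivative of the exponential cost is an affine function of the
unnormalized weighted error. -/
theorem neg_deriv_expCost_eq {m : ℕ} (y F h : Fin m → ℝ) (hy : ∀ i, y i = 1 ∨ y i = -1)
    (hh : ∀ i, h i = 1 ∨ h i = -1) :
    -(deriv (fun s : ℝ => (1 / (m : ℝ)) * ∑ i, Real.exp (-(y i) * (F + s • h) i)) 0)
      = (1 / (m : ℝ)) * (∑ i, Real.exp (-(y i) * F i)
        - 2 * ∑ i ∈ Finset.univ.filter (fun i => h i ≠ y i), Real.exp (-(y i) * F i)) := by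
  have hderiv : HasDerivAt
      (fun s : ℝ => (1 / (m : ℝ)) * ∑ i, Real.exp (-(y i) * (F + s • h) i))
      ((1 / (m : ℝ)) * ∑ i, Real.exp (-(y i) * (F i + 0 * h i)) * (-(y i) * (1 * h i))) 0 := by
    refine HasDerivAt.const_mul _ (HasDerivAt.fun_sum fun i _ => ?_)
    simp only [Pi.add_apply, Pi.smul_apply, smul_eq_mul]
    exact ((((hasDerivAt_id (0 : ℝ)).mul_const (h i)).const_add (F i)).const_mul (-(y i))).exp
  rw [hderiv.deriv, ← mul_neg, Finset.sum_filter, Finset.mul_sum, ← Finset.sum_neg_distrib,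
    ← Finset.sum_sub_distrib]
  congr 1
  refine Finset.sum_congr rfl fun i _ => ?_
  rcases hy i with h₁ | h₁ <;> rcases hh i with h₂ | h₂ <;> norm_num [h₁, h₂] <;> ring

/-- AdaBoost as gradient descent: maximizing the negative directional derivative of the
exponential cost is equivalent to minimizing the weighted error. -/
theorem adaboost_gradient_descent_selection_equiv
    (m : ℕ) (hm : 1 ≤ m)
    (y F : Fin m → ℝ) (hy : ∀ i, y i = 1 ∨ y i = -1)
    (C : (Fin m → ℝ) → ℝ)
    (hC : ∀ G, C G = (1 / m) * ∑ i, Real.exp (-(y i) * G i))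
    (W : Fin m → ℝ)
    (hW : ∀ i, W i = Real.exp (-(y i) * F i) / ∑ j, Real.exp (-(y j) * F j))
    (H : Finset (Fin m → ℝ)) (hH : H.Nonempty)
    (hHpm : ∀ h ∈ H, ∀ i, h i = 1 ∨ h i = -1)
    (hstar : Fin m → ℝ) (hstarH : hstar ∈ H) :
    (∀ h ∈ H, -(deriv (fun s : ℝ => C (F + s • h)) 0)
        ≤ -(deriv (fun s : ℝ => C (F + s • hstar)) 0))
      ↔
    (∀ h ∈ H, ∑ i ∈ Finset.univ.filter (fun i => hstar i ≠ y i), W i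
        ≤ ∑ i ∈ Finset.univ.filter (fun i => h i ≠ y i), W i) := by
  have hm₀ : (0 : ℝ) < 1 / m := one_div_pos.mpr (by exact_mod_cast hm)
  have hne : (Finset.univ : Finset (Fin m)).Nonempty := ⟨⟨0, hm⟩, Finset.mem_univ _⟩
  have hZ : 0 < ∑ j, Real.exp (-(y j) * F j) :=
    Finset.sum_pos (fun i _ => Real.exp_pos _) hne
  refine forall₂_congr fun h hhH => ?_
  simp only [hC, hW]
  rw [neg_deriv_expCost_eq y F h hy (hHpm h hhH),
    neg_deriv_expCost_eq y F hstar hy (hHpm hstar hstarH), mul_le_mul_iff_right₀ hm₀,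
    ← Finset.sum_div, ← Finset.sum_div, div_le_div_iff_of_pos_right hZ]
  constructor <;> intro hle <;> linarith
end

section
/- Relative entropy minimization theorem (Kivinen–Warmuth duality for the AdaBoost update): Let q ∈ Δ_m with q_i > 0 for all i, and let η ∈ {−1,1}^m take both values +1 and −1. Set Z(α) = ∑_{i=1}^m q_i·exp(−α η_i). Then min over { W ∈ Δ_m : ∑_{i=1}^m W_i η_i = 0 } of KL(W‖q) equals max over α ∈ ℝ of −log Z(α), and both the constrained minimum and the unconstrained maximum are attained. -/
open Finset

/-- The Fenchel–Young inequality for `x ↦ x * log (x / q)`. -/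
lemma mul_add_sub_mul_exp_le_mul_log_div {w q : ℝ} (hw : 0 ≤ w) (hq : 0 < q) (c : ℝ) :
    w * c + w - q * Real.exp c ≤ w * Real.log (w / q) := by
  rcases hw.eq_or_lt with rfl | hw
  · simpa using (mul_pos hq (Real.exp_pos c)).le
  have h := Real.log_le_sub_one_of_pos (x := q * Real.exp c / w) (by positivity)
  rw [Real.log_div (by positivity) hw.ne', Real.log_mul hq.ne' (Real.exp_pos c).ne',
    Real.log_exp] at h
  rw [Real.log_div hw.ne' hq.ne']
  have h' := mul_le_mul_of_nonneg_left h hw.le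
  rw [mul_sub w (q * Real.exp c / w) 1, mul_div_cancel₀ _ hw.ne'] at h'
  linarith

/-- The weak duality between relative entropy under a linear constraint and the log-partition
function. -/
lemma neg_log_partition_le_relative_entropy {ι : Type*} [Fintype ι] {q W η : ι → ℝ}
    (hq : ∀ i, 0 < q i) (hW : ∀ i, 0 ≤ W i) (hWs : ∑ i, W i = 1)
    (hWη : ∑ i, W i * η i = 0) (α : ℝ) (hZ : 0 < ∑ i, q i * Real.exp (-α * η i)) :
    -Real.log (∑ i, q i * Real.exp (-α * η i)) ≤ ∑ i, W i * Real.log (W i / q i) := by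
  set Z := ∑ i, q i * Real.exp (-α * η i) with hZdef
  have h := Finset.sum_le_sum fun i (_ : i ∈ Finset.univ) =>
    mul_add_sub_mul_exp_le_mul_log_div (hW i) (hq i) (-α * η i - Real.log Z)
  refine le_of_eq_of_le ?_ h
  have h₁ : ∑ i, q i * Real.exp (-α * η i - Real.log Z) = 1 := by
    simp_rw [Real.exp_sub, Real.exp_log hZ, ← mul_div_assoc]
    rw [← Finset.sum_div, ← hZdef, div_self hZ.ne']
  have h₂ : ∑ i, W i * (-α * η i - Real.log Z) = -Real.log Z := by
    calc ∑ i, W i * (-α * η i - Real.log Z)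
        = -α * ∑ i, W i * η i - (∑ i, W i) * Real.log Z := by
          rw [Finset.mul_sum, Finset.sum_mul, ← Finset.sum_sub_distrib]
          exact Finset.sum_congr rfl fun i _ => by ring
      _ = -Real.log Z := by rw [hWη, hWs]; ring
  rw [Finset.sum_sub_distrib, Finset.sum_add_distrib, h₁, h₂, hWs]
  ring

/-- The partition function of a dichotomy taking both signs has a critical point. -/
lemma exists_sum_mul_exp_mul_eq_zero {ι : Type*} [Fintype ι] {q η : ι → ℝ}
    (hq : ∀ i, 0 < q i) (hη : ∀ i, η i = 1 ∨ η i = -1)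
    (hplus : ∃ i, η i = 1) (hminus : ∃ i, η i = -1) :
    ∃ α : ℝ, ∑ i, q i * Real.exp (-α * η i) * η i = 0 := by
  set A := ∑ i, q i * ((1 + η i) / 2) with hA
  set B := ∑ i, q i * ((1 - η i) / 2) with hB
  have hApos : 0 < A := by
    obtain ⟨j, hj⟩ := hplus
    refine Finset.sum_pos' (fun i _ => mul_nonneg (hq i).le ?_) ⟨j, Finset.mem_univ j, ?_⟩
    · rcases hη i with h | h <;> norm_num [h]
    · simpa [hj] using hq j
  have hBpos : 0 < B := by
    obtain ⟨j, hj⟩ := hminus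
    refine Finset.sum_pos' (fun i _ => mul_nonneg (hq i).le ?_) ⟨j, Finset.mem_univ j, ?_⟩
    · rcases hη i with h | h <;> norm_num [h]
    · norm_num [hj, hq j]
  refine ⟨(Real.log A - Real.log B) / 2, ?_⟩
  set α := (Real.log A - Real.log B) / 2 with hα
  have h_split : ∑ i, q i * Real.exp (-α * η i) * η i = A * Real.exp (-α) - B * Real.exp α := by
    rw [hA, hB, Finset.sum_mul, Finset.sum_mul, ← Finset.sum_sub_distrib]
    refine Finset.sum_congr rfl fun i _ => ?_
    rcases hη i with h | h <;> norm_num [h]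
  have h_balance : A * Real.exp (-α) = B * Real.exp α := by
    nth_rewrite 1 [← Real.exp_log hApos]
    nth_rewrite 1 [← Real.exp_log hBpos]
    rw [← Real.exp_add, ← Real.exp_add, hα]
    ring_nf
  rw [h_split, h_balance, sub_self]

/-- Relative entropy minimization theorem (Kivinen–Warmuth duality): the constrained
minimum of `KL(W‖q)` over the hyperplane `∑ W i η i = 0` equals the maximum over
`α ∈ ℝ` of `−log Z(α)`, and both are attained. -/
theorem kivinen_warmuth_duality
    (m : ℕ) (q : Fin m → ℝ) (hq : ∀ i, 0 < q i) (hqs : ∑ i, q i = 1)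
    (η : Fin m → ℝ) (hη : ∀ i, η i = 1 ∨ η i = -1)
    (hplus : ∃ i, η i = 1) (hminus : ∃ i, η i = -1) :
    ∃ v : ℝ,
      IsLeast
        {r : ℝ | ∃ W : Fin m → ℝ, (∀ i, 0 ≤ W i) ∧ (∑ i, W i = 1) ∧
          (∑ i, W i * η i = 0) ∧ r = ∑ i, W i * Real.log (W i / q i)} v ∧
      IsGreatest
        {r : ℝ | ∃ α : ℝ, r = -Real.log (∑ i, q i * Real.exp (-α * η i))} v := by
  have hZ (α : ℝ) : 0 < ∑ i, q i * Real.exp (-α * η i) := by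
    obtain ⟨j, -⟩ := hplus
    exact Finset.sum_pos (fun i _ => mul_pos (hq i) (Real.exp_pos _)) ⟨j, Finset.mem_univ j⟩
  obtain ⟨α, hα⟩ := exists_sum_mul_exp_mul_eq_zero hq hη hplus hminus
  set Z := ∑ i, q i * Real.exp (-α * η i) with hZdef
  have hZpos : 0 < Z := hZ α
  set p : Fin m → ℝ := fun i => q i * Real.exp (-α * η i) / Z with hp
  have hp_nonneg (i : Fin m) : 0 ≤ p i :=
    div_nonneg (mul_pos (hq i) (Real.exp_pos _)).le hZpos.le
  have hp_sum : ∑ i, p i = 1 := by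
    rw [← Finset.sum_div, ← hZdef, div_self hZpos.ne']
  have hp_orth : ∑ i, p i * η i = 0 := by
    simp_rw [hp, div_mul_eq_mul_div]
    rw [← Finset.sum_div, hα, zero_div]
  have hp_log (i : Fin m) : Real.log (p i / q i) = -α * η i - Real.log Z := by
    have h : p i / q i = Real.exp (-α * η i) / Z := by
      have := (hq i).ne'
      simp only [hp]
      field_simp
    rw [h, Real.log_div (Real.exp_pos _).ne' hZpos.ne', Real.log_exp]
  have hp_entropy : ∑ i, p i * Real.log (p i / q i) = -Real.log Z := by
    calc ∑ i, p i * Real.log (p i / q i)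
        = -α * ∑ i, p i * η i - (∑ i, p i) * Real.log Z := by
          rw [Finset.mul_sum, Finset.sum_mul, ← Finset.sum_sub_distrib]
          exact Finset.sum_congr rfl fun i _ => by rw [hp_log]; ring
      _ = -Real.log Z := by rw [hp_orth, hp_sum]; ring
  refine ⟨-Real.log Z, ⟨⟨p, hp_nonneg, hp_sum, hp_orth, hp_entropy.symm⟩, ?_⟩, ⟨α, rfl⟩, ?_⟩
  · rintro _ ⟨W, hW, hWs, hWη, rfl⟩
    exact neg_log_partition_le_relative_entropy hq hW hWs hWη α hZpos
  · rintro _ ⟨β, rfl⟩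
    rw [← hp_entropy]
    exact neg_log_partition_le_relative_entropy hq hp_nonneg hp_sum hp_orth β (hZ β)
end

section
/- Totally corrective update duality: Let q ∈ Δ_m with q_i > 0 for all i, and let η_1,…,η_T ∈ ℝ^m. Assume there exists W ∈ Δ_m with all W_i > 0 such that ∑_i W_i η_{s,i} = 0 for every s = 1,…,T. Then the minimum over { W ∈ Δ_m : ∑_i W_i η_{s,i} = 0 for all s = 1,…,T } of KL(W‖q) is attained and equals sup over α ∈ ℝ^T of −log( ∑_{i=1}^m q_i·exp(−∑_{s=1}^T α_s η_{s,i}) ). -/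
open Finset

/-- Weak duality: every value of the dual objective bounds the relative entropy of every
feasible point from below. -/
lemma neg_log_partition_le_relEntropy {ι : Type*} [Fintype ι] {q W u : ι → ℝ}
    (hq : ∀ i, 0 < q i) (hW : ∀ i, 0 ≤ W i) (hW1 : ∑ i, W i = 1)
    (hWu : ∑ i, W i * u i = 0) :
    -Real.log (∑ i, q i * Real.exp (-u i)) ≤ ∑ i, W i * Real.log (W i / q i) := by
  have hne : (univ : Finset ι).Nonempty := by
    by_contra h
    rw [Finset.not_nonempty_iff_eq_empty] at h
    simp [h] at hW1
  set Z := ∑ i, q i * Real.exp (-u i) with hZ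
  have hZpos : 0 < Z := Finset.sum_pos (fun i _ => mul_pos (hq i) (Real.exp_pos _)) hne
  have hterm : ∀ i, W i - q i * Real.exp (-u i) / Z - W i * u i - W i * Real.log Z
      ≤ W i * Real.log (W i / q i) := by
    intro i
    have hp : 0 < q i * Real.exp (-u i) / Z :=
      div_pos (mul_pos (hq i) (Real.exp_pos _)) hZpos
    rcases (hW i).eq_or_lt with h0 | h0
    · rw [← h0]
      simpa using hp.le
    · have h1 := Real.log_le_sub_one_of_pos (div_pos hp h0)
      rw [Real.log_div hp.ne' h0.ne',
        Real.log_div (mul_pos (hq i) (Real.exp_pos _)).ne' hZpos.ne',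
        Real.log_mul (hq i).ne' (Real.exp_pos _).ne', Real.log_exp] at h1
      rw [Real.log_div h0.ne' (hq i).ne']
      have h2 := mul_le_mul_of_nonneg_left h1 h0.le
      have h3 : W i * (q i * Real.exp (-u i) / Z / W i - 1)
          = q i * Real.exp (-u i) / Z - W i := by
        field_simp
      rw [h3] at h2
      linarith
  have hsum := Finset.sum_le_sum fun i (_ : i ∈ univ) => hterm i
  simp only [Finset.sum_sub_distrib] at hsum
  rw [← Finset.sum_div, ← Finset.sum_mul, hW1, hWu, ← hZ, div_self hZpos.ne'] at hsum
  linarith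

/-- A positive weighted sum of exponentials attains its minimum on a subspace orthogonal to
a strictly positive vector. -/
lemma exists_forall_sum_exp_neg_le {ι : Type*} [Fintype ι] {q W : ι → ℝ}
    (hq : ∀ i, 0 < q i) (hqs : ∑ i, q i = 1) (hW : ∀ i, 0 < W i)
    (V : Submodule ℝ (ι → ℝ)) (hWV : ∀ v ∈ V, ∑ i, W i * v i = 0) :
    ∃ v ∈ V, ∀ w ∈ V, ∑ i, q i * Real.exp (-v i) ≤ ∑ i, q i * Real.exp (-w i) := by
  have hlog : ∀ i, Real.log (q i) ≤ 0 := fun i =>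
    Real.log_nonpos (hq i).le
      (hqs ▸ Finset.single_le_sum (fun j _ => (hq j).le) (Finset.mem_univ i))
  set C : ℝ := -∑ j, W j * Real.log (q j) with hC
  have hC0 : 0 ≤ C := by
    rw [hC, ← Finset.sum_neg_distrib]
    exact Finset.sum_nonneg fun j _ => by
      have := mul_nonneg (hW j).le (neg_nonneg.2 (hlog j))
      linarith
  let K : Set (ι → ℝ) := Set.Icc (fun i => Real.log (q i)) (fun i => C / W i) ∩ V
  have hK : IsCompact K := isCompact_Icc.inter_right V.closed_of_finiteDimensional
  have h0K : (0 : ι → ℝ) ∈ K :=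
    ⟨⟨fun i => hlog i, fun i => div_nonneg hC0 (hW i).le⟩, V.zero_mem⟩
  have hcont : Continuous fun v : ι → ℝ => ∑ i, q i * Real.exp (-v i) := by fun_prop
  obtain ⟨v, hvK, hv⟩ := hK.exists_isMinOn ⟨0, h0K⟩ hcont.continuousOn
  refine ⟨v, hvK.2, fun w hw => ?_⟩
  by_cases hw1 : ∑ i, q i * Real.exp (-w i) ≤ 1
  · refine hv (show w ∈ K from ?_)
    have hlow : ∀ i, Real.log (q i) ≤ w i := by
      intro i
      have h1 : q i * Real.exp (-w i) ≤ 1 :=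
        (Finset.single_le_sum (f := fun j => q j * Real.exp (-w j))
          (fun j _ => (mul_pos (hq j) (Real.exp_pos _)).le) (Finset.mem_univ i)).trans hw1
      have h2 := Real.log_nonpos (mul_pos (hq i) (Real.exp_pos _)).le h1
      rw [Real.log_mul (hq i).ne' (Real.exp_pos _).ne', Real.log_exp] at h2
      linarith
    refine ⟨⟨hlow, fun i => ?_⟩, hw⟩
    rw [le_div_iff₀ (hW i)]
    have h3 : W i * (w i - Real.log (q i)) ≤ ∑ j, W j * (w j - Real.log (q j)) :=
      Finset.single_le_sum (f := fun j => W j * (w j - Real.log (q j)))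
        (fun j _ => mul_nonneg (hW j).le (sub_nonneg.2 (hlow j))) (Finset.mem_univ i)
    simp only [mul_sub, Finset.sum_sub_distrib] at h3
    rw [hWV w hw] at h3
    have h4 := mul_nonneg (hW i).le (neg_nonneg.2 (hlog i))
    linarith
  · have h0 : ∑ i, q i * Real.exp (-v i) ≤ ∑ i, q i * Real.exp (-(0 : ι → ℝ) i) := hv h0K
    simp only [Pi.zero_apply, neg_zero, Real.exp_zero, mul_one, hqs] at h0
    linarith

/-- First-order optimality for a minimizer of a weighted sum of exponentials along a line. -/
lemma sum_mul_exp_neg_mul_eq_zero {ι : Type*} [Fintype ι] {q v d : ι → ℝ}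
    (h : ∀ t : ℝ, ∑ i, q i * Real.exp (-v i) ≤ ∑ i, q i * Real.exp (-(v i + t * d i))) :
    ∑ i, q i * Real.exp (-v i) * d i = 0 := by
  have hder : HasDerivAt (fun t : ℝ => ∑ i, q i * Real.exp (-(v i + t * d i)))
      (∑ i, q i * (Real.exp (-(v i + 0 * d i)) * -(1 * d i))) 0 :=
    HasDerivAt.fun_sum fun i _ =>
      ((((hasDerivAt_id (0 : ℝ)).mul_const (d i)).const_add (v i)).neg.exp).const_mul (q i)
  have hmin : IsLocalMin (fun t : ℝ => ∑ i, q i * Real.exp (-(v i + t * d i))) 0 :=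
    Filter.Eventually.of_forall fun t => by simpa using h t
  have h0 := hmin.hasDerivAt_eq_zero hder
  rw [← neg_eq_zero, ← Finset.sum_neg_distrib, ← h0]
  refine Finset.sum_congr rfl fun i _ => ?_
  rw [zero_mul, add_zero]
  ring

/-- Totally corrective update duality: under a strictly feasible point, the constrained
minimum of `KL(W‖q)` over the intersection of the `T` hyperplanes is attained and equals
the supremum of the dual objective over `α ∈ ℝ^T`. -/
theorem totally_corrective_duality
    (m T : ℕ) (q : Fin m → ℝ) (hq : ∀ i, 0 < q i) (hqs : ∑ i, q i = 1)
    (η : Fin T → Fin m → ℝ)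
    (hslater : ∃ W : Fin m → ℝ, (∀ i, 0 < W i) ∧ (∑ i, W i = 1) ∧
      ∀ s : Fin T, ∑ i, W i * η s i = 0) :
    ∃ v : ℝ,
      IsLeast
        {r : ℝ | ∃ W : Fin m → ℝ, (∀ i, 0 ≤ W i) ∧ (∑ i, W i = 1) ∧
          (∀ s : Fin T, ∑ i, W i * η s i = 0) ∧
          r = ∑ i, W i * Real.log (W i / q i)} v ∧
      v = ⨆ α : Fin T → ℝ,
            -Real.log (∑ i, q i * Real.exp (-(∑ s, α s * η s i))) := by
  obtain ⟨W₀, hW₀, -, hW₀η⟩ := hslater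
  have hlin : ∀ (W : Fin m → ℝ), (∀ s, ∑ i, W i * η s i = 0) → ∀ α : Fin T → ℝ,
      ∑ i, W i * ∑ s, α s * η s i = 0 := by
    intro W hW α
    simp only [Finset.mul_sum]
    rw [Finset.sum_comm]
    refine Finset.sum_eq_zero fun s _ => ?_
    rw [← mul_zero (α s), ← hW s, Finset.mul_sum]
    exact Finset.sum_congr rfl fun i _ => by ring
  obtain ⟨v, hvV, hvmin⟩ := exists_forall_sum_exp_neg_le hq hqs hW₀
    (Submodule.span ℝ (Set.range η)) (by
      intro v hv
      obtain ⟨α, rfl⟩ := (Submodule.mem_span_range_iff_exists_fun ℝ).1 hv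
      simpa using hlin W₀ hW₀η α)
  obtain ⟨α, hα⟩ := (Submodule.mem_span_range_iff_exists_fun ℝ).1 hvV
  have hvα : ∀ i, ∑ s, α s * η s i = v i := fun i => by simp [← hα]
  have hopt : ∀ s, ∑ i, q i * Real.exp (-v i) * η s i = 0 := fun s =>
    sum_mul_exp_neg_mul_eq_zero fun t => hvmin (v + t • η s)
      (add_mem hvV (Submodule.smul_mem _ _ (Submodule.subset_span ⟨s, rfl⟩)))
  have hne : (univ : Finset (Fin m)).Nonempty := by
    by_contra h
    rw [Finset.not_nonempty_iff_eq_empty] at h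
    simp [h] at hqs
  set Z := ∑ i, q i * Real.exp (-v i) with hZ
  have hZpos : 0 < Z := Finset.sum_pos (fun i _ => mul_pos (hq i) (Real.exp_pos _)) hne
  set W : Fin m → ℝ := fun i => q i * Real.exp (-v i) / Z with hWdef
  have hW0 : ∀ i, 0 ≤ W i := fun i => (div_pos (mul_pos (hq i) (Real.exp_pos _)) hZpos).le
  have hW1 : ∑ i, W i = 1 := by
    rw [hWdef, ← Finset.sum_div, ← hZ, div_self hZpos.ne']
  have hWη : ∀ s, ∑ i, W i * η s i = 0 := fun s => by
    simp only [hWdef, div_mul_eq_mul_div]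
    rw [← Finset.sum_div, hopt s, zero_div]
  have hWv : ∑ i, W i * v i = 0 := by
    simpa only [hvα] using hlin W hWη α
  have hWval : ∑ i, W i * Real.log (W i / q i) = -Real.log Z := by
    have hlog : ∀ i, Real.log (W i / q i) = -v i - Real.log Z := fun i => by
      have : W i / q i = Real.exp (-v i) / Z := by
        have := (hq i).ne'
        simp only [hWdef]
        field_simp
      rw [this, Real.log_div (Real.exp_pos _).ne' hZpos.ne', Real.log_exp]
    simp only [hlog, mul_sub, mul_neg, Finset.sum_sub_distrib, Finset.sum_neg_distrib]
    rw [hWv, ← Finset.sum_mul, hW1]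
    ring
  have hdual : -Real.log (∑ i, q i * Real.exp (-(∑ s, α s * η s i))) = -Real.log Z := by
    simp only [hvα, hZ]
  have hle : ∀ β : Fin T → ℝ,
      -Real.log (∑ i, q i * Real.exp (-(∑ s, β s * η s i))) ≤ -Real.log Z := fun β =>
    hWval ▸ neg_log_partition_le_relEntropy hq hW0 hW1 (hlin W hWη β)
  refine ⟨-Real.log Z, ⟨⟨W, hW0, hW1, hWη, hWval.symm⟩, ?_⟩, le_antisymm ?_ (ciSup_le hle)⟩
  · rintro r ⟨W', hW'0, hW'1, hW'η, rfl⟩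
    rw [← hdual]
    exact neg_log_partition_le_relEntropy hq hW'0 hW'1 (hlin W' hW'η α)
  · rw [← hdual]
    exact le_ciSup (f := fun β : Fin T → ℝ =>
      -Real.log (∑ i, q i * Real.exp (-(∑ s, β s * η s i))))
      ⟨_, Set.forall_mem_range.2 hle⟩ α
end

section
/- Invariance of the entropy projection along the exponential curve: Let q ∈ Δ_m with q_i > 0 for all i, let η ∈ {−1,1}^m take both values, let ε₀ = ∑_{i : η_i = −1} q_i, α* = (1/2)·log((1−ε₀)/ε₀), Z(α) = ∑_i q_i·exp(−α η_i), and W*_i = q_i·exp(−α* η_i)/Z(α*). For each α ∈ ℝ define W(α) ∈ Δ_m by W(α)_i = q_i·exp(−α η_i)/Z(α). Then for every α ∈ ℝ, W* is the unique minimizer of KL(W‖W(α)) over { W ∈ Δ_m : ∑_i W_i η_i = 0 }; in particular the projection of W(α) onto this hyperplane does not depend on α. -/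
open scoped Classical
open Finset

/-- The pointwise inequality behind the Gibbs inequality. -/
lemma sub_lt_mul_log_div {w p : ℝ} (hw : 0 ≤ w) (hp : 0 < p) (hne : w ≠ p) :
    w - p < w * Real.log (w / p) := by
  rcases hw.eq_or_lt with rfl | hw
  · simpa using hp
  have h : Real.log (p / w) < p / w - 1 :=
    Real.log_lt_sub_one_of_pos (div_pos hp hw) fun h => hne ((div_eq_one_iff_eq hw.ne').1 h).symm
  have h' : w * Real.log (p / w) < p - w := by
    calc w * Real.log (p / w) < w * (p / w - 1) := by gcongr
      _ = p - w := by field_simp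
  rw [← inv_div p w, Real.log_inv]
  linarith

/-- Strict Gibbs inequality for finite distributions. -/
lemma sum_mul_log_div_pos {ι : Type*} [Fintype ι] {W P : ι → ℝ} (hW : ∀ i, 0 ≤ W i)
    (hP : ∀ i, 0 < P i) (hsum : ∑ i, W i = ∑ i, P i) (hne : W ≠ P) :
    0 < ∑ i, W i * Real.log (W i / P i) := by
  obtain ⟨j, hj⟩ := Function.ne_iff.1 hne
  calc 0 = ∑ i, (W i - P i) := by rw [Finset.sum_sub_distrib, hsum, sub_self]
    _ < ∑ i, W i * Real.log (W i / P i) := by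
      refine Finset.sum_lt_sum (fun i _ => ?_) ⟨j, Finset.mem_univ j, ?_⟩
      · by_cases h : W i = P i
        · simp [h, (hP i).ne']
        · exact (sub_lt_mul_log_div (hW i) (hP i) h).le
      · exact sub_lt_mul_log_div (hW j) (hP j) hj

/-- If the log-ratio of `P` to `Q` is affine in `η`, then on the hyperplane `∑ W i * η i = 0`
the relative entropies with respect to `P` and to `Q` differ by a constant. -/
lemma sum_mul_log_div_eq_add_const {ι : Type*} [Fintype ι] {W P Q η : ι → ℝ} {b c : ℝ}
    (hP : ∀ i, 0 < P i) (hQ : ∀ i, 0 < Q i)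
    (hlog : ∀ i, Real.log (P i / Q i) = b * η i + c)
    (hsum : ∑ i, W i = 1) (hη : ∑ i, W i * η i = 0) :
    ∑ i, W i * Real.log (W i / Q i) = ∑ i, W i * Real.log (W i / P i) + c := by
  have key : ∀ i, W i * Real.log (W i / Q i) =
      W i * Real.log (W i / P i) + (b * (W i * η i) + c * W i) := by
    intro i
    by_cases h : W i = 0
    · simp [h]
    · rw [← div_mul_div_cancel₀ (hP i).ne', Real.log_mul (div_ne_zero h (hP i).ne')
        (div_pos (hP i) (hQ i)).ne', hlog]
      ring
  simp_rw [key, Finset.sum_add_distrib, ← Finset.mul_sum, hsum, hη]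
  ring

/-- The signed exponential sum vanishes at the critical value of the parameter. -/
lemma sum_mul_exp_mul_sign_eq_zero {ι : Type*} [Fintype ι] {q η : ι → ℝ}
    (hq : ∀ i, 0 < q i) (hqs : ∑ i, q i = 1) (hη : ∀ i, η i = 1 ∨ η i = -1)
    (hplus : ∃ i, η i = 1) (hminus : ∃ i, η i = -1) {ε a : ℝ}
    (hε : ε = ∑ i ∈ Finset.univ.filter (fun i => η i = -1), q i)
    (ha : a = (1 / 2) * Real.log ((1 - ε) / ε)) :
    ∑ i, q i * Real.exp (-a * η i) * η i = 0 := by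
  have hε0 : 0 < ε := by
    obtain ⟨j, hj⟩ := hminus
    rw [hε]
    exact Finset.sum_pos (fun i _ => hq i) ⟨j, by simp [hj]⟩
  have hε1 : 0 < 1 - ε := by
    obtain ⟨j, hj⟩ := hplus
    rw [sub_pos, ← hqs, hε]
    refine Finset.sum_lt_sum_of_subset (Finset.filter_subset _ _) (Finset.mem_univ j) ?_ (hq j)
      fun i _ _ => (hq i).le
    rw [Finset.mem_filter, hj]
    norm_num
  have hexp : Real.exp a * Real.exp a = (1 - ε) / ε := by
    rw [← Real.exp_add, ← Real.exp_log (div_pos hε1 hε0), ha]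
    ring_nf
  have hsum : ∑ i, q i * Real.exp (-a * η i) * η i =
      Real.exp (-a) - ε * (Real.exp (-a) + Real.exp a) := by
    have key : ∀ i, q i * Real.exp (-a * η i) * η i =
        q i * Real.exp (-a) - (if η i = -1 then q i else 0) * (Real.exp (-a) + Real.exp a) := by
      intro i
      rcases hη i with h | h
      · rw [h, if_neg (by norm_num)]; simp
      · rw [h, if_pos rfl, neg_mul_neg, mul_one]; ring
    simp_rw [key, Finset.sum_sub_distrib, ← Finset.sum_mul, hqs, ← Finset.sum_filter, ← hε,
      one_mul]
  rw [hsum, Real.exp_neg]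
  field_simp at hexp ⊢
  linarith

/-- Invariance of the entropy projection along the exponential curve: for every `α`,
`W*` is the unique minimizer of `KL(·‖W(α))` over the hyperplane `∑ W i η i = 0`. -/
theorem entropy_projection_invariance
    (m : ℕ) (q : Fin m → ℝ) (hq : ∀ i, 0 < q i) (hqs : ∑ i, q i = 1)
    (η : Fin m → ℝ) (hη : ∀ i, η i = 1 ∨ η i = -1)
    (hplus : ∃ i, η i = 1) (hminus : ∃ i, η i = -1)
    (ε₀ : ℝ) (hε₀ : ε₀ = ∑ i ∈ Finset.univ.filter (fun i => η i = -1), q i)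
    (αstar : ℝ) (hαstar : αstar = (1 / 2) * Real.log ((1 - ε₀) / ε₀))
    (Z : ℝ → ℝ) (hZ : ∀ α, Z α = ∑ i, q i * Real.exp (-α * η i))
    (Wstar : Fin m → ℝ)
    (hWstar : ∀ i, Wstar i = q i * Real.exp (-αstar * η i) / Z αstar)
    (Wc : ℝ → Fin m → ℝ)
    (hWc : ∀ α i, Wc α i = q i * Real.exp (-α * η i) / Z α) :
    ∀ α : ℝ,
      ((∀ i, 0 ≤ Wstar i) ∧ (∑ i, Wstar i = 1) ∧ (∑ i, Wstar i * η i = 0)) ∧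
      ∀ W : Fin m → ℝ, (∀ i, 0 ≤ W i) → (∑ i, W i = 1) → (∑ i, W i * η i = 0) →
        W ≠ Wstar →
          ∑ i, Wstar i * Real.log (Wstar i / Wc α i)
            < ∑ i, W i * Real.log (W i / Wc α i) := by
  have hZpos : ∀ α, 0 < Z α := fun α => by
    rw [hZ]
    exact Finset.sum_pos (fun i _ => mul_pos (hq i) (Real.exp_pos _))
      (hplus.imp fun i _ => Finset.mem_univ i)
  have hWcpos : ∀ α i, 0 < Wc α i := fun α i => by
    rw [hWc]
    exact div_pos (mul_pos (hq i) (Real.exp_pos _)) (hZpos α)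
  obtain rfl : Wstar = Wc αstar := funext fun i => by rw [hWstar, hWc]
  have hsum : ∑ i, Wc αstar i = 1 := by
    simp_rw [hWc, ← Finset.sum_div, ← hZ]
    exact div_self (hZpos αstar).ne'
  have horth : ∑ i, Wc αstar i * η i = 0 := by
    simp_rw [hWc, div_mul_eq_mul_div, ← Finset.sum_div]
    rw [sum_mul_exp_mul_sign_eq_zero hq hqs hη hplus hminus hε₀ hαstar, zero_div]
  intro α
  refine ⟨⟨fun i => (hWcpos αstar i).le, hsum, horth⟩, fun W hW hWs hWη hne => ?_⟩
  have hlog : ∀ i, Real.log (Wc αstar i / Wc α i) =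
      (α - αstar) * η i + (Real.log (Z α) - Real.log (Z αstar)) := by
    intro i
    have hlogWc : ∀ β, Real.log (Wc β i) = Real.log (q i) + -β * η i - Real.log (Z β) := by
      intro β
      rw [hWc, Real.log_div (mul_pos (hq i) (Real.exp_pos _)).ne' (hZpos β).ne',
        Real.log_mul (hq i).ne' (Real.exp_pos _).ne', Real.log_exp]
    rw [Real.log_div (hWcpos αstar i).ne' (hWcpos α i).ne', hlogWc, hlogWc]
    ring
  rw [sum_mul_log_div_eq_add_const (hWcpos αstar) (hWcpos α) hlog hsum horth,
    sum_mul_log_div_eq_add_const (hWcpos αstar) (hWcpos α) hlog hWs hWη]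
  have hself : ∑ i, Wc αstar i * Real.log (Wc αstar i / Wc αstar i) = 0 :=
    Finset.sum_eq_zero fun i _ => by rw [div_self (hWcpos αstar i).ne', Real.log_one, mul_zero]
  rw [hself]
  gcongr
  exact sum_mul_log_div_pos hW (hWcpos αstar) (hWs.trans hsum.symm) hne
end

section
/- The boosting iterate is a kernel-based estimator (boosting kernel identity): Let P be an m×m real symmetric positive semidefinite matrix and σ > 0, and set S = P·(P + σ² I)⁻¹, so that I − S = σ²·(P + σ² I)⁻¹ is invertible. For t ≥ 1 define the boosting kernel P_t = σ²·( (I − S)^{−t} − I ). Then P_t + σ² I = σ²·(I − S)^{−t} is invertible and P_t·(P_t + σ² I)⁻¹ = I − (I − S)^t = S·∑_{i=0}^{t−1} (I − S)^i; in other words, the t-th boosting iterate S·∑_{i=0}^{t−1}(I−S)^i·y coincides with the kernel-based estimator P_t·(P_t + σ² I)⁻¹·y. -/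
open Finset Matrix

/-- The boosting iterate is a kernel-based estimator (boosting kernel identity). -/
theorem boosting_kernel_identity
    (m : ℕ) (P : Matrix (Fin m) (Fin m) ℝ) (hP : P.PosSemidef)
    (σ : ℝ) (hσ : 0 < σ) (t : ℕ) (ht : 1 ≤ t)
    (S : Matrix (Fin m) (Fin m) ℝ)
    (hS : S = P * (P + σ ^ 2 • (1 : Matrix (Fin m) (Fin m) ℝ))⁻¹)
    (Pt : Matrix (Fin m) (Fin m) ℝ)
    (hPt : Pt = σ ^ 2 • (((1 - S)⁻¹) ^ t - 1)) :
    (1 - S = σ ^ 2 • (P + σ ^ 2 • (1 : Matrix (Fin m) (Fin m) ℝ))⁻¹) ∧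
    IsUnit (1 - S) ∧
    (Pt + σ ^ 2 • (1 : Matrix (Fin m) (Fin m) ℝ) = σ ^ 2 • ((1 - S)⁻¹) ^ t) ∧
    IsUnit (Pt + σ ^ 2 • (1 : Matrix (Fin m) (Fin m) ℝ)) ∧
    (Pt * (Pt + σ ^ 2 • (1 : Matrix (Fin m) (Fin m) ℝ))⁻¹ = 1 - (1 - S) ^ t) ∧
    (Pt * (Pt + σ ^ 2 • (1 : Matrix (Fin m) (Fin m) ℝ))⁻¹
      = S * ∑ i ∈ Finset.range t, (1 - S) ^ i) := by
  have hc : 0 < σ ^ 2 := by positivity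
  have hA : IsUnit (P + σ ^ 2 • (1 : Matrix (Fin m) (Fin m) ℝ)).det :=
    (Matrix.isUnit_iff_isUnit_det _).mp
      (Matrix.PosDef.posSemidef_add hP (Matrix.PosDef.one.smul hc)).isUnit
  have hsub : 1 - S = σ ^ 2 • (P + σ ^ 2 • (1 : Matrix (Fin m) (Fin m) ℝ))⁻¹ := by
    have hinv := Matrix.mul_nonsing_inv _ hA
    rw [add_mul, smul_mul_assoc, one_mul] at hinv
    rw [hS, sub_eq_iff_eq_add', hinv]
  have hU : IsUnit (1 - S) := by
    rw [hsub]
    exact (Matrix.isUnit_nonsing_inv_iff.mpr ((Matrix.isUnit_iff_isUnit_det _).mpr hA)).smul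
      (Units.mk0 _ hc.ne')
  have hadd : Pt + σ ^ 2 • (1 : Matrix (Fin m) (Fin m) ℝ) = σ ^ 2 • ((1 - S)⁻¹) ^ t := by
    rw [hPt, smul_sub, sub_add_cancel]
  have hcancel : ((1 - S)⁻¹) ^ t * (1 - S) ^ t = 1 := by
    rw [Matrix.inv_pow']
    exact Matrix.nonsing_inv_mul _ ((Matrix.isUnit_iff_isUnit_det _).mp (hU.pow t))
  have hright : (σ ^ 2 • ((1 - S)⁻¹) ^ t) * ((σ ^ 2)⁻¹ • (1 - S) ^ t) = 1 := by
    rw [smul_mul_smul_comm, hcancel, mul_inv_cancel₀ hc.ne', one_smul]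
  have hest : Pt * (Pt + σ ^ 2 • (1 : Matrix (Fin m) (Fin m) ℝ))⁻¹ = 1 - (1 - S) ^ t := by
    rw [hadd, Matrix.inv_eq_right_inv hright, hPt, smul_mul_smul_comm, mul_inv_cancel₀ hc.ne',
      one_smul, sub_mul, hcancel, one_mul]
  refine ⟨hsub, hU, hadd, ?_, hest, ?_⟩
  · rw [hadd]
    exact IsUnit.of_mul_eq_one _ hright
  · rw [hest, ← mul_neg_geom_sum, sub_sub_cancel]
end

section
/- Equivalence of the Product-of-Experts weight update with the AdaBoost weight update: Let ε ∈ (0,1) and α = (1/2)·log((1−ε)/ε). Then ε = exp(−α)/(exp(−α) + exp(α)); for any y, h ∈ {−1,1}, exp(−α·y·h)/(exp(−α) + exp(α)) equals ε if h = y and equals 1 − ε if h ≠ y. Consequently, for any weights W ∈ Δ_m, labels y ∈ {−1,1}^m and classifier h ∈ {−1,1}^m, the Product-of-Experts update vector with entries W_i·ε for i with h_i = y_i and W_i·(1−ε) for i with h_i ≠ y_i equals (1/(exp(−α)+exp(α)))·(W_i·exp(−α y_i h_i))_{i=1..m}; hence after normalization to Δ_m the Product-of-Experts update and the AdaBoost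 update produce the same weight vector. -/
open scoped Classical
open Finset

/-- The error probability is recovered from half its log-odds. -/
theorem eq_exp_div_of_eq_half_log_odds {ε α : ℝ} (hε0 : 0 < ε) (hε1 : ε < 1)
    (hα : α = (1 / 2) * Real.log ((1 - ε) / ε)) :
    ε = Real.exp (-α) / (Real.exp (-α) + Real.exp α) := by
  have hodds : Real.exp α = (1 - ε) / ε * Real.exp (-α) := by
    rw [← Real.exp_log (div_pos (sub_pos.2 hε1) hε0), ← Real.exp_add]
    congr 1
    linarith
  rw [eq_div_iff (by positivity), hodds]
  field_simp
  ring

/-- The normalized exponential loss is the Product-of-Experts update factor. -/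
theorem exp_div_eq_ite_of_eq_exp_div {ε α : ℝ}
    (hε : ε = Real.exp (-α) / (Real.exp (-α) + Real.exp α))
    {y h : ℝ} (hy : y = 1 ∨ y = -1) (hh : h = 1 ∨ h = -1) :
    Real.exp (-α * (y * h)) / (Real.exp (-α) + Real.exp α)
      = if h = y then ε else 1 - ε := by
  have hne : Real.exp (-α) + Real.exp α ≠ 0 := by positivity
  have hε' : 1 - ε = Real.exp α / (Real.exp (-α) + Real.exp α) := by
    rw [hε]
    field_simp
    ring
  rw [hε']
  rcases hy with rfl | rfl <;> rcases hh with rfl | rfl <;> norm_num <;> exact hε.symm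

/-- Equivalence of the Product-of-Experts weight update with the AdaBoost weight
update. -/
theorem poe_update_eq_adaboost_update
    (m : ℕ) (hm : 1 ≤ m)
    (ε : ℝ) (hε0 : 0 < ε) (hε1 : ε < 1)
    (α : ℝ) (hα : α = (1 / 2) * Real.log ((1 - ε) / ε)) :
    (ε = Real.exp (-α) / (Real.exp (-α) + Real.exp α)) ∧
    (∀ y h : ℝ, (y = 1 ∨ y = -1) → (h = 1 ∨ h = -1) →
      Real.exp (-α * (y * h)) / (Real.exp (-α) + Real.exp α)
        = if h = y then ε else 1 - ε) ∧
    (∀ (W : Fin m → ℝ), (∀ i, 0 ≤ W i) → (∑ i, W i = 1) →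
      ∀ (y h : Fin m → ℝ), (∀ i, y i = 1 ∨ y i = -1) → (∀ i, h i = 1 ∨ h i = -1) →
        (∀ i, (if h i = y i then W i * ε else W i * (1 - ε))
          = (1 / (Real.exp (-α) + Real.exp α)) * (W i * Real.exp (-α * (y i * h i)))) ∧
        ∀ i, (if h i = y i then W i * ε else W i * (1 - ε))
              / (∑ j, if h j = y j then W j * ε else W j * (1 - ε))
            = W i * Real.exp (-α * (y i * h i))
              / (∑ j, W j * Real.exp (-α * (y j * h j)))) := by
  have hε := eq_exp_div_of_eq_half_log_odds hε0 hε1 hα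
  refine ⟨hε, fun y h hy hh => exp_div_eq_ite_of_eq_exp_div hε hy hh, ?_⟩
  intro W _ _ y h hy hh
  have hupdate : ∀ i, (if h i = y i then W i * ε else W i * (1 - ε))
      = (1 / (Real.exp (-α) + Real.exp α)) * (W i * Real.exp (-α * (y i * h i))) := by
    intro i
    rw [← mul_ite, ← exp_div_eq_ite_of_eq_exp_div hε (hy i) (hh i)]
    ring
  refine ⟨hupdate, fun i => ?_⟩
  simp_rw [hupdate]
  rw [← Finset.mul_sum, mul_div_mul_left _ _ (by positivity)]
end
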